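/- (Global asymptotic stability criterion, second-order version.) Let a > 0, c > 0 and σ ≤ μ < 0. Set N = max{N₀, φ(0)} and τ = a + c·N, and suppose φ is continuous with φ(t) ≥ M₀ for all t ∈ [−τ, 0]. Suppose that the only pair (M, N') ∈ [M₀, 0] × [0, N₀] satisfying Q₂(N', M, N') = 0 and Q₂(M, N', M) = 0 is M = N' = 0. Then every solution u of the SDDE satisfies u(t) → 0 as t → ∞. -/

import Mathlib

open Real Set Filter

/-- `M₀ = -a/c`. -/
noncomputable def Mzero (a c : ℝ) : ℝ := -a / c

/-- `N₀ = aσ/(cμ)`. -/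
noncomputable def Nzero (a c μ σ : ℝ) : ℝ := a * σ / (c * μ)

/-- A solution of the SDDE `u'(t) = μ u(t) + σ u(t - a - c u(t))` with history `φ`:
a continuous function equal to `φ` on `(-∞,0]`, differentiable on `(0,∞)` with
continuous derivative there, satisfying the SDDE for all `t > 0`. -/
def IsSDDESolution (a c μ σ : ℝ) (φ u : ℝ → ℝ) : Prop :=
  Continuous u ∧ (∀ t ≤ (0:ℝ), u t = φ t) ∧
  ContinuousOn (deriv u) (Set.Ioi (0:ℝ)) ∧
  ∀ t > (0:ℝ), HasDerivAt u (μ * u t + σ * u (t - a - c * u t)) t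

/-- `Q₁(v,x) = (1 + (μ/σ) e^{μ(a+cv)}) v + (σ/μ) x (1 - e^{μ(a+cv)})`. -/
noncomputable def Qone (a c μ σ v x : ℝ) : ℝ :=
  (1 + (μ / σ) * Real.exp (μ * (a + c * v))) * v +
    (σ / μ) * x * (1 - Real.exp (μ * (a + c * v)))

/-- `D(x,y) = (|μ|+|σ|)(1 + (|μ|+|σ|) max(|x|,|y|) c) max(|x|,|y|)`. -/
noncomputable def Dfun (c μ σ x y : ℝ) : ℝ :=
  (|μ| + |σ|) * (1 + (|μ| + |σ|) * max |x| |y| * c) * max |x| |y|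

/-- The piecewise function `Q₂(v,x,y)`. -/
noncomputable def Qtwo (a c μ σ v x y : ℝ) : ℝ :=
  let s := Real.sign (y - x)
  let D := Dfun c μ σ x y
  if -s * (x + (μ / σ) * v) / D < a + c * v then
    (μ / σ) * v * Real.exp (μ * (a + c * v)) -
      (σ / μ) * (s * (D / μ) *
        (Real.exp (-μ * s * (x + (μ / σ) * v) / D) - 1) +
        x * Real.exp (μ * (a + c * v)))
  else
    v * Real.exp (μ * (a + c * v)) * (1 + μ / σ) -
      s * (σ / μ) * D *
        ((1 / μ) * (Real.exp (μ * (a + c * v)) - 1) -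
          (a + c * v) * Real.exp (μ * (a + c * v)))


/-- Right-hand side of the variation-of-constants inequality over a time window of length `r`:
the value at the left end of the window is `p`, and the delayed term is bounded below by
`max x (p - d * θ)` at distance `θ` from the right end. -/
noncomputable def windowBound (μ σ r x p d : ℝ) : ℝ :=
  p * exp (μ * r) + σ * ∫ θ in (0:ℝ)..r, exp (μ * θ) * max x (p - d * θ)

lemma continuous_windowBound_comp {X : Type*} [TopologicalSpace X] {μ σ : ℝ}
    {r x p d : X → ℝ} (hr : Continuous r) (hx : Continuous x) (hp : Continuous p)
    (hd : Continuous d) :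
    Continuous fun z => windowBound μ σ (r z) (x z) (p z) (d z) := by
  unfold windowBound
  have h : Continuous fun z => ∫ θ in (0:ℝ)..(r z), exp (μ * θ) * max (x z) (p z - d z * θ) := by
    apply intervalIntegral.continuous_parametric_intervalIntegral_of_continuous _ hr
    fun_prop
  fun_prop

lemma windowBound_mono {μ σ r x x' p d d' : ℝ} (hσ : σ < 0) (hr : 0 ≤ r) (hx : x' ≤ x)
    (hd : d ≤ d') : windowBound μ σ r x p d ≤ windowBound μ σ r x' p d' := by
  unfold windowBound
  have h : ∫ θ in (0:ℝ)..r, exp (μ * θ) * max x' (p - d' * θ) ≤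
      ∫ θ in (0:ℝ)..r, exp (μ * θ) * max x (p - d * θ) := by
    apply intervalIntegral.integral_mono_on hr
    · exact Continuous.intervalIntegrable (by fun_prop) _ _
    · exact Continuous.intervalIntegrable (by fun_prop) _ _
    · intro θ hθ
      have := mul_le_mul_of_nonneg_right hd hθ.1
      gcongr
  have := mul_le_mul_of_nonpos_left h hσ.le
  linarith

lemma integral_exp_mul_const {μ : ℝ} (hμ : μ ≠ 0) (s r x : ℝ) :
    ∫ θ in s..r, exp (μ * θ) * x = x / μ * (exp (μ * r) - exp (μ * s)) := by
  have := intervalIntegral.integral_eq_sub_of_hasDerivAt (a := s) (b := r)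
    (f := fun θ => exp (μ * θ) * x / μ) (f' := fun θ => exp (μ * θ) * x) ?_ ?_
  · rw [this]; ring
  · intro θ _
    have h := ((((hasDerivAt_id θ).const_mul μ).exp).mul_const x).div_const μ
    refine h.congr_deriv ?_
    simp only [id]
    field_simp
  · exact Continuous.intervalIntegrable (by fun_prop) _ _

lemma integral_exp_mul_affine {μ : ℝ} (hμ : μ ≠ 0) (r p d : ℝ) :
    ∫ θ in (0:ℝ)..r, exp (μ * θ) * (p - d * θ) =
      (exp (μ * r) * (p - d * r) - p) / μ + d / μ ^ 2 * (exp (μ * r) - 1) := by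
  have := intervalIntegral.integral_eq_sub_of_hasDerivAt (a := 0) (b := r)
    (f := fun θ => exp (μ * θ) * ((p - d * θ) / μ + d / μ ^ 2))
    (f' := fun θ => exp (μ * θ) * (p - d * θ)) ?_ ?_
  · rw [this]; simp; ring
  · intro θ _
    have h1 := ((hasDerivAt_id θ).const_mul μ).exp
    have h2 := ((((hasDerivAt_id θ).const_mul d).const_sub p).div_const μ).add_const (d / μ ^ 2)
    refine (h1.mul h2).congr_deriv ?_
    simp only [id]
    field_simp
    ring
  · exact Continuous.intervalIntegrable (by fun_prop) _ _

lemma windowBound_of_le {μ σ r x p d : ℝ} (hμ : μ ≠ 0) (hr : 0 ≤ r) (hd : 0 ≤ d) (hpx : p ≤ x) :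
    windowBound μ σ r x p d = p * exp (μ * r) + σ / μ * x * (exp (μ * r) - 1) := by
  unfold windowBound
  have h : ∫ θ in (0:ℝ)..r, exp (μ * θ) * max x (p - d * θ) =
      ∫ θ in (0:ℝ)..r, exp (μ * θ) * x := by
    apply intervalIntegral.integral_congr
    intro θ hθ
    rw [uIcc_of_le hr] at hθ
    have := mul_nonneg hd hθ.1
    simp only
    rw [max_eq_left (by linarith)]
  rw [h, integral_exp_mul_const hμ]
  simp
  ring

/-- Closed form of `v - windowBound` for `p = -(μ/σ) v`. -/
lemma sub_windowBound_eq {μ σ r x v d : ℝ} (hμ : μ ≠ 0) (hσ : σ ≠ 0) (hr : 0 ≤ r) (hd : 0 < d)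
    (hx : x + μ / σ * v ≤ 0) :
    v - windowBound μ σ r x (-(μ / σ * v)) d =
      if -(x + μ / σ * v) / d < r then
        μ / σ * v * exp (μ * r) -
          σ / μ * (d / μ * (exp (-μ * (x + μ / σ * v) / d) - 1) + x * exp (μ * r))
      else
        v * exp (μ * r) * (1 + μ / σ) -
          σ / μ * d * (1 / μ * (exp (μ * r) - 1) - r * exp (μ * r)) := by
  set p := -(μ / σ * v) with hp
  set s := -(x + μ / σ * v) / d with hs
  have hs0 : 0 ≤ s := div_nonneg (by linarith) hd.le
  have hds : d * s = p - x := by rw [hs, hp]; field_simp; ring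
  have hv : v = -(σ / μ * p) := by rw [hp]; field_simp
  have hlow : ∀ q, 0 ≤ q → q ≤ s → ∫ θ in (0:ℝ)..q, exp (μ * θ) * max x (p - d * θ) =
      ∫ θ in (0:ℝ)..q, exp (μ * θ) * (p - d * θ) := by
    intro q hq hqs
    apply intervalIntegral.integral_congr
    intro θ hθ
    rw [uIcc_of_le hq] at hθ
    have := mul_le_mul_of_nonneg_left (hθ.2.trans hqs) hd.le
    simp only
    rw [max_eq_right (by linarith)]
  unfold windowBound
  split_ifs with h
  · have hhigh : ∫ θ in s..r, exp (μ * θ) * max x (p - d * θ) =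
        ∫ θ in s..r, exp (μ * θ) * x := by
      apply intervalIntegral.integral_congr
      intro θ hθ
      rw [uIcc_of_le h.le] at hθ
      have := mul_le_mul_of_nonneg_left hθ.1 hd.le
      simp only
      rw [max_eq_left (by linarith)]
    rw [← intervalIntegral.integral_add_adjacent_intervals (b := s)
      (Continuous.intervalIntegrable (by fun_prop) _ _)
      (Continuous.intervalIntegrable (by fun_prop) _ _),
      hlow s hs0 le_rfl, hhigh, integral_exp_mul_affine hμ, integral_exp_mul_const hμ,
      show -μ * (x + μ / σ * v) / d = μ * s by rw [hs]; ring,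
      show μ / σ * v = -p by rw [hp]; ring, hv, show p - d * s = x by linarith]
    field_simp
    ring
  · rw [hlow r hr (not_lt.1 h), integral_exp_mul_affine hμ, hv]
    field_simp
    ring

lemma le_of_le_windowBound {μ σ r x v d : ℝ} (hμ : μ < 0) (hσ : σ < 0) (hr : 0 ≤ r) (hd : 0 ≤ d)
    (hx : x ≤ 0) (hv : 0 ≤ v) (h : v ≤ windowBound μ σ r x (-(μ / σ * v)) d) :
    x + μ / σ * v ≤ 0 := by
  by_contra! hlt
  rw [windowBound_of_le hμ.ne hr hd (by linarith)] at h
  have he : exp (μ * r) ≤ 1 := exp_le_one_iff.2 (mul_nonpos_of_nonpos_of_nonneg hμ.le hr)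
  have he0 := exp_pos (μ * r)
  have hρ : 0 < μ / σ := div_pos_of_neg_of_neg hμ hσ
  have hρ' : 0 < σ / μ := div_pos_of_neg_of_neg hσ hμ
  have hinv : σ / μ * (μ / σ) = 1 := by
    have := hμ.ne
    have := hσ.ne
    field_simp
  have hv0 : 0 < v := by
    rcases hv.eq_or_lt with h0 | h0
    · rw [← h0] at hlt; simp at hlt; linarith
    · exact h0
  have h1 : σ / μ * x * (exp (μ * r) - 1) ≤ v * (1 - exp (μ * r)) := by
    have h2 : -(σ / μ * x) ≤ v := by
      have := mul_le_mul_of_nonneg_left hlt.le hρ'.le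
      rw [mul_add, ← mul_assoc, hinv] at this
      linarith
    nlinarith
  nlinarith [mul_pos (mul_pos hρ hv0) he0, mul_pos hv0 he0]

lemma Dfun_comm (c μ σ x y : ℝ) : Dfun c μ σ x y = Dfun c μ σ y x := by
  simp only [Dfun, max_comm]

lemma Dfun_nonneg {c : ℝ} (hc : 0 ≤ c) (μ σ x y : ℝ) : 0 ≤ Dfun c μ σ x y := by
  unfold Dfun; positivity

lemma Dfun_pos {c μ : ℝ} (hc : 0 ≤ c) (hμ : μ ≠ 0) (σ : ℝ) {x y : ℝ} (h : x ≠ y) :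
    0 < Dfun c μ σ x y := by
  have h1 : 0 < max |x| |y| := by
    rcases eq_or_ne x 0 with rfl | hx
    · exact lt_max_of_lt_right (abs_pos.2 h.symm)
    · exact lt_max_of_lt_left (abs_pos.2 hx)
  have := abs_pos.2 hμ
  unfold Dfun; positivity

lemma Dfun_mono {c : ℝ} (hc : 0 ≤ c) (μ σ : ℝ) {x y x' y' : ℝ}
    (h : max |x| |y| ≤ max |x'| |y'|) : Dfun c μ σ x y ≤ Dfun c μ σ x' y' := by
  unfold Dfun; gcongr

lemma continuous_Dfun_comp {X : Type*} [TopologicalSpace X] {c μ σ : ℝ} {x y : X → ℝ}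
    (hx : Continuous x) (hy : Continuous y) : Continuous fun z => Dfun c μ σ (x z) (y z) := by
  unfold Dfun; fun_prop

lemma Qtwo_eq_of_lt {a c μ σ v x y : ℝ} (hμ : μ ≠ 0) (hσ : σ ≠ 0) (hc : 0 ≤ c)
    (hr : 0 ≤ a + c * v) (hxy : x < y) (hx : x + μ / σ * v ≤ 0) :
    Qtwo a c μ σ v x y =
      v - windowBound μ σ (a + c * v) x (-(μ / σ * v)) (Dfun c μ σ x y) := by
  rw [sub_windowBound_eq hμ hσ hr (Dfun_pos hc hμ σ hxy.ne) hx]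
  simp only [Qtwo, Real.sign_of_pos (sub_pos.2 hxy)]
  simp

lemma Qtwo_eq_of_gt {a c μ σ v x y : ℝ} (hμ : μ ≠ 0) (hσ : σ ≠ 0) (hc : 0 ≤ c)
    (hr : 0 ≤ a + c * v) (hxy : y < x) (hx : 0 ≤ x + μ / σ * v) :
    Qtwo a c μ σ v x y =
      v + windowBound μ σ (a + c * v) (-x) (-(μ / σ * -v)) (Dfun c μ σ x y) := by
  have h := sub_windowBound_eq (x := -x) (v := -v) hμ hσ hr (Dfun_pos hc hμ σ hxy.ne')
    (by linarith)
  rw [show v + windowBound μ σ (a + c * v) (-x) (-(μ / σ * -v)) (Dfun c μ σ x y) =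
    -(-v - windowBound μ σ (a + c * v) (-x) (-(μ / σ * -v)) (Dfun c μ σ x y)) by ring, h]
  have e1 : -x + μ / σ * -v = -(x + μ / σ * v) := by ring
  simp only [Qtwo, Real.sign_of_neg (sub_neg.2 hxy), e1]
  simp only [neg_neg, one_mul, mul_neg, neg_mul, mul_one]
  split_ifs <;> ring

/-- Near-maximal values of a function that is bounded above along a half-line are attained
at points where the derivative is small. -/
lemma exists_abs_deriv_le_of_near_sup {u u' : ℝ → ℝ} {L T ε t₁ : ℝ} (hε : 0 < ε)
    (hd : ∀ t ≥ T, HasDerivAt u (u' t) t) (hub : ∀ t ≥ T, u t ≤ L + ε) (ht₁ : T + 1 ≤ t₁)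
    (h₁ : L - ε ≤ u t₁) : ∃ t ≥ t₁ - 1, |u t - L| ≤ ε ∧ |u' t| ≤ 6 * ε := by
  have hcont : ContinuousOn (fun t => u t - 3 * ε * (t - t₁) ^ 2) (Icc (t₁ - 1) (t₁ + 1)) := by
    intro t ht
    have := (hd t (by linarith [ht.1])).continuousAt
    exact ContinuousAt.continuousWithinAt (by fun_prop)
  obtain ⟨t, ht, hmax⟩ := isCompact_Icc.exists_isMaxOn
    (nonempty_Icc.2 (by linarith)) hcont
  have hge : u t₁ ≤ u t - 3 * ε * (t - t₁) ^ 2 := by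
    simpa using hmax (show t₁ ∈ Icc (t₁ - 1) (t₁ + 1) from ⟨by linarith, by linarith⟩)
  have hut := hub t (by linarith [ht.1])
  have hsq : (t - t₁) ^ 2 < 1 := by
    by_contra! h
    nlinarith
  have habs := abs_lt.1 ((sq_lt_one_iff_abs_lt_one _).1 hsq)
  have hloc : IsLocalMax (fun t => u t - 3 * ε * (t - t₁) ^ 2) t :=
    hmax.isLocalMax (Icc_mem_nhds (by linarith) (by linarith))
  have hder : HasDerivAt (fun t => u t - 3 * ε * (t - t₁) ^ 2) (u' t - 6 * ε * (t - t₁)) t := by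
    have h := (hd t (by linarith [ht.1])).sub
      ((((hasDerivAt_id t).sub_const t₁).pow 2).const_mul (3 * ε))
    refine h.congr_deriv ?_
    simp
    ring
  have h0 := hloc.hasDerivAt_eq_zero hder
  refine ⟨t, ht.1, abs_le.2 ⟨?_, by linarith⟩, abs_le.2 ⟨?_, ?_⟩⟩
  · have : 0 ≤ 3 * ε * (t - t₁) ^ 2 := by positivity
    linarith
  · nlinarith
  · nlinarith

section DelayEquation

variable {a c μ σ τ T : ℝ} {u : ℝ → ℝ}

lemma abs_sub_le_of_bounds {m K : ℝ}
    (hde : ∀ t ≥ T, HasDerivAt u (μ * u t + σ * u (t - a - c * u t)) t)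
    (hdelay : ∀ t ≥ T, 0 ≤ a + c * u t ∧ a + c * u t ≤ τ)
    (hb : ∀ t ≥ T, m ≤ u t ∧ u t ≤ K) {s t : ℝ} (hs : T + τ ≤ s) (ht : T + τ ≤ t) :
    |u s - u t| ≤ (|μ| + |σ|) * max |m| |K| * |s - t| := by
  have hτ : 0 ≤ τ := (hdelay T le_rfl).1.trans (hdelay T le_rfl).2
  have habs : ∀ t ≥ T, |u t| ≤ max |m| |K| := fun t ht =>
    abs_le_max_abs_abs (hb t ht).1 (hb t ht).2
  have := Convex.norm_image_sub_le_of_norm_hasDerivWithin_le (s := Ici (T + τ)) (f := u)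
    (f' := fun t => μ * u t + σ * u (t - a - c * u t)) (C := (|μ| + |σ|) * max |m| |K|)
    (fun t ht => (hde t (by linarith [mem_Ici.1 ht])).hasDerivWithinAt) ?_ (convex_Ici _)
    (mem_Ici.2 ht) (mem_Ici.2 hs)
  · simpa only [Real.norm_eq_abs] using this
  · intro t ht
    have ht := mem_Ici.1 ht
    have h1 := habs t (by linarith)
    have h2 := habs (t - a - c * u t) (by linarith [(hdelay t (by linarith)).2])
    calc ‖μ * u t + σ * u (t - a - c * u t)‖
        ≤ |μ| * |u t| + |σ| * |u (t - a - c * u t)| := by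
          rw [← abs_mul, ← abs_mul]; exact abs_add_le _ _
      _ ≤ |μ| * max |m| |K| + |σ| * max |m| |K| := by gcongr
      _ = _ := by ring

lemma le_windowBound_of_bounds {m K t : ℝ} (hu : Continuous u) (hσ : σ < 0)
    (hde : ∀ t ≥ T, HasDerivAt u (μ * u t + σ * u (t - a - c * u t)) t)
    (hdelay : ∀ t ≥ T, 0 ≤ a + c * u t ∧ a + c * u t ≤ τ)
    (hb : ∀ t ≥ T, m ≤ u t ∧ u t ≤ K) (ht : T + 3 * τ ≤ t) :
    u t ≤ windowBound μ σ (a + c * u t) m (u (t - a - c * u t)) (Dfun |c| μ σ m K) := by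
  have hτ : 0 ≤ τ := (hdelay T le_rfl).1.trans (hdelay T le_rfl).2
  have hr := hdelay t (by linarith)
  set r := a + c * u t with hrdef
  set p := u (t - a - c * u t) with hp
  set Λ := (|μ| + |σ|) * max |m| |K| with hΛ
  have hΛ0 : 0 ≤ Λ := by positivity
  have hlip : ∀ θ ∈ Icc 0 r,
      p - Dfun |c| μ σ m K * θ ≤ u (t - θ - a - c * u (t - θ)) := by
    intro θ hθ
    have h1 := abs_sub_le_of_bounds hde hdelay hb
      (s := t) (t := t - θ) (by linarith) (by linarith [hθ.2])
    have h2 := abs_sub_le_of_bounds hde hdelay hb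
      (s := t - a - c * u t) (t := t - θ - a - c * u (t - θ)) (by linarith [hr.2])
      (by linarith [hθ.2, (hdelay (t - θ) (by linarith [hθ.2])).2])
    rw [← hΛ] at h1 h2
    rw [sub_sub_cancel, abs_of_nonneg hθ.1] at h1
    have h3 : |t - a - c * u t - (t - θ - a - c * u (t - θ))| ≤ (1 + |c| * Λ) * θ := by
      calc |t - a - c * u t - (t - θ - a - c * u (t - θ))|
          = |θ - c * (u t - u (t - θ))| := by congr 1; ring
        _ ≤ |θ| + |c * (u t - u (t - θ))| := abs_sub _ _
        _ = θ + |c| * |u t - u (t - θ)| := by rw [abs_mul, abs_of_nonneg hθ.1]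
        _ ≤ θ + |c| * (Λ * θ) := by gcongr
        _ = _ := by ring
    have h4 := (le_abs_self _).trans (h2.trans (mul_le_mul_of_nonneg_left h3 hΛ0))
    have h5 : Dfun |c| μ σ m K * θ = Λ * ((1 + |c| * Λ) * θ) := by
      rw [Dfun, hΛ]; ring
    linarith
  have hvoc : exp (μ * r) * p - u t =
      ∫ θ in (0:ℝ)..r, -σ * (exp (μ * θ) * u (t - θ - a - c * u (t - θ))) := by
    rw [intervalIntegral.integral_eq_sub_of_hasDerivAt
      (f := fun θ => exp (μ * θ) * u (t - θ))]
    · simp [hp, hrdef, sub_sub]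
    · intro θ hθ
      rw [uIcc_of_le hr.1] at hθ
      have h1 := ((hasDerivAt_id θ).const_mul μ).exp
      have h2 : HasDerivAt (fun θ => u (t - θ)) _ θ :=
        (hde (t - θ) (by linarith [hθ.2])).comp_const_sub t θ
      refine (h1.mul h2).congr_deriv ?_
      simp only [id]
      ring
    · exact Continuous.intervalIntegrable (by fun_prop) _ _
  have hint : ∫ θ in (0:ℝ)..r, exp (μ * θ) * max m (p - Dfun |c| μ σ m K * θ) ≤
      ∫ θ in (0:ℝ)..r, exp (μ * θ) * u (t - θ - a - c * u (t - θ)) := by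
    apply intervalIntegral.integral_mono_on hr.1
    · exact Continuous.intervalIntegrable (by fun_prop) _ _
    · exact Continuous.intervalIntegrable (by fun_prop) _ _
    · intro θ hθ
      have h1 := (hb (t - θ - a - c * u (t - θ))
        (by linarith [hθ.2, (hdelay (t - θ) (by linarith [hθ.2])).2])).1
      exact mul_le_mul_of_nonneg_left (max_le h1 (hlip θ hθ)) (exp_pos _).le
  rw [intervalIntegral.integral_const_mul] at hvoc
  unfold windowBound
  have := mul_le_mul_of_nonpos_left hint hσ.le
  linarith

lemma limsup_le_windowBound {ℓ L : ℝ} (hu : Continuous u) (hσ : σ < 0)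
    (hde : ∀ t ≥ T, HasDerivAt u (μ * u t + σ * u (t - a - c * u t)) t)
    (hdelay : ∀ t ≥ T, 0 ≤ a + c * u t ∧ a + c * u t ≤ τ)
    (hb : ∀ ε > 0, ∀ᶠ t in atTop, ℓ - ε ≤ u t ∧ u t ≤ L + ε)
    (hfreq : ∀ ε > 0, ∃ᶠ t in atTop, L - ε ≤ u t) :
    L ≤ windowBound μ σ (a + c * L) ℓ (-(μ / σ * L)) (Dfun |c| μ σ ℓ L) := by
  have hτ : 0 ≤ τ := (hdelay T le_rfl).1.trans (hdelay T le_rfl).2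
  have key : ∀ ε > 0, ∃ v w : ℝ, |v - L| ≤ ε ∧ |w| ≤ 6 * ε ∧
      v ≤ windowBound μ σ (a + c * v) (ℓ - ε) ((w - μ * v) / σ)
        (Dfun |c| μ σ (ℓ - ε) (L + ε)) := by
    intro ε hε
    obtain ⟨T₁, hT₁⟩ := eventually_atTop.1 (hb ε hε)
    obtain ⟨t₁, ht₁, h₁⟩ := frequently_atTop.1 (hfreq ε hε) (max T T₁ + 3 * τ + 1)
    have hT : T ≤ max T T₁ := le_max_left _ _
    have hT' : T₁ ≤ max T T₁ := le_max_right _ _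
    obtain ⟨t, ht, hv, hw⟩ := exists_abs_deriv_le_of_near_sup (T := max T T₁) hε
      (fun t ht => hde t (hT.trans ht)) (fun t ht => (hT₁ t (hT'.trans ht)).2)
      (by linarith) h₁
    refine ⟨u t, _, hv, hw, ?_⟩
    rw [add_sub_cancel_left, mul_div_cancel_left₀ _ hσ.ne]
    exact le_windowBound_of_bounds (T := max T T₁) hu hσ (fun t ht => hde t (hT.trans ht))
      (fun t ht => hdelay t (hT.trans ht)) (fun t ht => hT₁ t (hT'.trans ht)) (by linarith)
  choose v w hv hw hle using fun n : ℕ => key (1 / ((n : ℝ) + 1)) Nat.one_div_pos_of_nat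
  have hε0 : Tendsto (fun n : ℕ => 1 / ((n : ℝ) + 1)) atTop (nhds 0) :=
    tendsto_one_div_add_atTop_nhds_zero_nat
  have hvL : Tendsto v atTop (nhds L) := tendsto_iff_norm_sub_tendsto_zero.2
    (squeeze_zero (fun _ => norm_nonneg _) hv hε0)
  have hw0 : Tendsto w atTop (nhds 0) := squeeze_zero_norm hw (by simpa using hε0.const_mul 6)
  have hcont : Continuous fun z : ℝ × ℝ × ℝ =>
      windowBound μ σ (a + c * z.1) (ℓ - z.2.2) ((z.2.1 - μ * z.1) / σ)
        (Dfun |c| μ σ (ℓ - z.2.2) (L + z.2.2)) :=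
    continuous_windowBound_comp (by fun_prop) (by fun_prop) (by fun_prop)
      (continuous_Dfun_comp (by fun_prop) (by fun_prop))
  have hlim := (hcont.tendsto (L, 0, 0)).comp (hvL.prodMk_nhds (hw0.prodMk_nhds hε0))
  have := le_of_tendsto_of_tendsto' hvL hlim hle
  simp only [sub_zero, add_zero, zero_sub] at this
  rwa [show -(μ / σ * L) = -(μ * L) / σ by ring]

lemma not_bounded_below_by_pos (hμ : μ < 0) (hσ : σ < 0)
    (hde : ∀ t ≥ T, HasDerivAt u (μ * u t + σ * u (t - a - c * u t)) t)
    (hdelay : ∀ t ≥ T, 0 ≤ a + c * u t ∧ a + c * u t ≤ τ) {η : ℝ} (hη : 0 < η)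
    (hb : ∀ t ≥ T, η ≤ u t) : False := by
  have hτ : 0 ≤ τ := (hdelay T le_rfl).1.trans (hdelay T le_rfl).2
  have hneg : (μ + σ) * η < 0 := mul_neg_of_neg_of_pos (by linarith) hη
  have hdec : ∀ t ≥ T + τ, u t - u (T + τ) ≤ (μ + σ) * η * (t - (T + τ)) := by
    intro t ht
    apply Convex.image_sub_le_mul_sub_of_deriv_le (convex_Ici (T + τ)) (f := u)
    · intro s hs
      exact (hde s (by linarith [mem_Ici.1 hs])).continuousAt.continuousWithinAt
    · intro s hs
      rw [interior_Ici] at hs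
      exact (hde s (by linarith [mem_Ioi.1 hs])).differentiableAt.differentiableWithinAt
    · intro s hs
      rw [interior_Ici] at hs
      have hs := mem_Ioi.1 hs
      rw [(hde s (by linarith)).deriv]
      have h1 := hb s (by linarith)
      have h2 := hb (s - a - c * u s) (by linarith [(hdelay s (by linarith)).2])
      nlinarith
    · exact mem_Ici.2 le_rfl
    · exact mem_Ici.2 ht
    · exact ht
  have hpos := (hη.trans_le (hb (T + τ) (by linarith)))
  have h := hdec (T + τ + u (T + τ) / -((μ + σ) * η))
    (by have := div_pos hpos (neg_pos.2 hneg); linarith)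
  have h' := hb (T + τ + u (T + τ) / -((μ + σ) * η))
    (by have := div_pos hpos (neg_pos.2 hneg); linarith)
  rw [add_sub_cancel_left, div_neg, mul_neg, mul_div_cancel₀ _ hneg.ne] at h
  linarith

end DelayEquation

lemma exists_last_zero {f : ℝ → ℝ} (hf : Continuous f) {t₁ : ℝ} (h0 : f 0 ≤ 0) (ht₁ : 0 ≤ t₁)
    (h₁ : 0 < f t₁) : ∃ t₀, 0 ≤ t₀ ∧ t₀ < t₁ ∧ f t₀ = 0 ∧ ∀ t, t₀ < t → t ≤ t₁ → 0 < f t := by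
  have hcpt : IsCompact (Icc 0 t₁ ∩ {t | f t ≤ 0}) :=
    isCompact_Icc.inter_right (isClosed_le hf continuous_const)
  obtain ⟨t₀, ⟨ht₀, hft₀⟩, hmax⟩ := hcpt.exists_isGreatest ⟨0, ⟨le_rfl, ht₁⟩, h0⟩
  obtain ⟨s, hs, hfs⟩ := intermediate_value_Icc ht₀.2 hf.continuousOn
    (show (0:ℝ) ∈ Icc (f t₀) (f t₁) from ⟨hft₀, h₁.le⟩)
  have hst : s = t₀ := le_antisymm (hmax ⟨⟨ht₀.1.trans hs.1, hs.2⟩, hfs.le⟩) hs.1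
  rw [hst] at hfs
  refine ⟨t₀, ht₀.1, lt_of_le_of_ne ht₀.2 ?_, hfs, ?_⟩
  · rintro rfl
    exact h₁.ne' hfs
  · intro t ht htt₁
    by_contra! h
    exact ht.not_ge (hmax ⟨⟨ht₀.1.trans ht.le, htt₁⟩, h⟩)

section Invariance

variable {a c μ σ : ℝ} {φ u : ℝ → ℝ}

lemma IsSDDESolution.exists_slope (hu : IsSDDESolution a c μ σ φ u) {s t : ℝ} (hs : 0 ≤ s)
    (hst : s < t) : ∃ ξ, s < ξ ∧ ξ < t ∧
      u t - u s = (μ * u ξ + σ * u (ξ - a - c * u ξ)) * (t - s) := by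
  obtain ⟨ξ, hξ, h⟩ := exists_hasDerivAt_eq_slope u
    (fun ξ => μ * u ξ + σ * u (ξ - a - c * u ξ)) hst hu.1.continuousOn
    (fun x hx => hu.2.2.2 x (hs.trans_lt hx.1))
  refine ⟨ξ, hξ.1, hξ.2, ?_⟩
  rw [h, div_mul_cancel₀ _ (by linarith)]

lemma IsSDDESolution.continuous_rhs (hu : IsSDDESolution a c μ σ φ u) :
    Continuous fun t => μ * u t + σ * u (t - a - c * u t) := by
  have := hu.1
  fun_prop

lemma IsSDDESolution.Mzero_le (hu : IsSDDESolution a c μ σ φ u) (ha : 0 < a) (hc : 0 < c)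
    (hμ : μ < 0) (hσ : σ < 0) (h0 : Mzero a c ≤ φ 0) {t : ℝ} (ht : 0 ≤ t) :
    Mzero a c ≤ u t := by
  by_contra! hlt
  obtain ⟨t₀, ht₀, ht₀t, hzero, hpos⟩ := exists_last_zero (f := fun t => Mzero a c - u t)
    (continuous_const.sub hu.1) (by rw [hu.2.1 0 le_rfl]; linarith) ht (by linarith)
  have hut₀ : u t₀ = Mzero a c := by linarith
  have hM : Mzero a c < 0 := div_neg_of_neg_of_pos (by linarith) hc
  have hcM : a + c * Mzero a c = 0 := by unfold Mzero; field_simp; ring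
  have hrhs : 0 < μ * u t₀ + σ * u (t₀ - a - c * u t₀) := by
    rw [hut₀, show t₀ - a - c * Mzero a c = t₀ by linarith, hut₀]
    exact add_pos (mul_pos_of_neg_of_neg hμ hM) (mul_pos_of_neg_of_neg hσ hM)
  obtain ⟨δ, hδ, hball⟩ := Metric.eventually_nhds_iff.1
    (hu.continuous_rhs.continuousAt.eventually (lt_mem_nhds hrhs))
  obtain ⟨s, hs₀, hs⟩ := exists_between (show t₀ < min t (t₀ + δ) from
    lt_min ht₀t (by linarith))
  obtain ⟨ξ, hξ₀, hξs, hslope⟩ := hu.exists_slope ht₀ hs₀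
  have hξ : 0 < μ * u ξ + σ * u (ξ - a - c * u ξ) := hball (by
    rw [Real.dist_eq, abs_of_pos (by linarith)]
    linarith [hs.trans_le (min_le_right _ _)])
  have := mul_pos hξ (sub_pos.2 hs₀)
  linarith [hpos s hs₀ (hs.le.trans (min_le_left _ _))]

lemma mul_Mzero_eq (hc : c ≠ 0) (hμ : μ ≠ 0) : σ * Mzero a c = -(μ * Nzero a c μ σ) := by
  unfold Mzero Nzero; field_simp

lemma IsSDDESolution.le_upper (hu : IsSDDESolution a c μ σ φ u) (hc : 0 < c)
    (hμ : μ < 0) (hσ : σ < 0) {N : ℝ} (hN₀ : Nzero a c μ σ ≤ N) (hφN : φ 0 ≤ N)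
    (hM : ∀ t ≥ -(a + c * N), Mzero a c ≤ u t) {t : ℝ} (ht : 0 ≤ t) : u t ≤ N := by
  by_contra! hlt
  obtain ⟨t₀, ht₀, ht₀t, hzero, hpos⟩ := exists_last_zero (f := fun t => u t - N)
    (hu.1.sub continuous_const) (by rw [hu.2.1 0 le_rfl]; linarith) ht (by linarith)
  have hut₀ : u t₀ = N := by linarith
  have hσM := mul_Mzero_eq (a := a) (σ := σ) hc.ne' hμ.ne
  have hrhs_le : ∀ s, t₀ ≤ s → u s ≤ N + (s - t₀) / c →
      μ * u s + σ * u (s - a - c * u s) ≤ μ * (u s - Nzero a c μ σ) := by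
    intro s hs hus
    have h1 : c * u s ≤ c * N + (s - t₀) := by
      have := mul_le_mul_of_nonneg_left hus hc.le
      rwa [mul_add, mul_div_cancel₀ _ hc.ne'] at this
    have := mul_le_mul_of_nonpos_left (hM (s - a - c * u s) (by linarith)) hσ.le
    linarith
  have hrhs : μ * u t₀ + σ * u (t₀ - a - c * u t₀) < 1 / c := by
    have h1 := hrhs_le t₀ le_rfl (by simp [hut₀])
    have h2 : μ * (u t₀ - Nzero a c μ σ) ≤ 0 :=
      mul_nonpos_of_nonpos_of_nonneg hμ.le (by linarith)
    have : 0 < 1 / c := by positivity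
    linarith
  obtain ⟨δ, hδ, hball⟩ := Metric.eventually_nhds_iff.1
    (hu.continuous_rhs.continuousAt.eventually (gt_mem_nhds hrhs))
  obtain ⟨s, hs₀, hs⟩ := exists_between (show t₀ < min t (t₀ + δ) from
    lt_min ht₀t (by linarith))
  have hst := hs.trans_le (min_le_left _ _)
  have hsδ := hs.trans_le (min_le_right _ _)
  have hgrow : ∀ q, t₀ < q → q < s → u q ≤ N + (q - t₀) / c := by
    intro q hq hqs
    obtain ⟨ξ, hξ₀, hξq, hslope⟩ := hu.exists_slope ht₀ hq
    have hξ : μ * u ξ + σ * u (ξ - a - c * u ξ) < 1 / c := hball (by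
      rw [Real.dist_eq, abs_of_pos (by linarith)]
      linarith)
    have := mul_le_mul_of_nonneg_right hξ.le (sub_pos.2 hq).le
    rw [one_div_mul_eq_div] at this
    linarith
  obtain ⟨ξ, hξ₀, hξs, hslope⟩ := hu.exists_slope ht₀ hs₀
  have h1 := hrhs_le ξ hξ₀.le (hgrow ξ hξ₀ hξs)
  have h2 : μ * (u ξ - Nzero a c μ σ) < 0 :=
    mul_neg_of_neg_of_pos hμ (by linarith [hpos ξ hξ₀ (by linarith)])
  have h3 := mul_neg_of_neg_of_pos (h1.trans_lt h2) (sub_pos.2 hs₀)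
  linarith [hpos s hs₀ hst.le]

lemma IsSDDESolution.eventually_le_Nzero_add (hu : IsSDDESolution a c μ σ φ u) (hc : 0 < c)
    (hμ : μ < 0) (hσ : σ < 0) (hM : ∀ t > 0, Mzero a c ≤ u (t - a - c * u t)) {ε : ℝ}
    (hε : 0 < ε) : ∀ᶠ t in atTop, u t ≤ Nzero a c μ σ + ε := by
  have hσM := mul_Mzero_eq (a := a) (σ := σ) hc.ne' hμ.ne
  set N₀ := Nzero a c μ σ
  have hder : ∀ t > 0, HasDerivAt (fun t => (u t - N₀) * exp (-μ * t))
      ((μ * u t + σ * u (t - a - c * u t)) * exp (-μ * t) +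
        (u t - N₀) * (exp (-μ * t) * (-μ))) t := by
    intro t ht
    have h := ((hu.2.2.2 t ht).sub_const N₀).mul ((hasDerivAt_id t).const_mul (-μ)).exp
    refine h.congr_deriv ?_
    simp
  have hanti : AntitoneOn (fun t => (u t - N₀) * exp (-μ * t)) (Ici 0) := by
    have := hu.1
    refine antitoneOn_of_deriv_nonpos (convex_Ici 0) (Continuous.continuousOn (by fun_prop))
      ?_ ?_
    · intro t ht
      rw [interior_Ici] at ht
      exact (hder t ht).differentiableAt.differentiableWithinAt
    · intro t ht
      rw [interior_Ici] at ht
      rw [(hder t ht).deriv]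
      have h1 := mul_le_mul_of_nonpos_left (hM t ht) hσ.le
      have := exp_pos (-μ * t)
      nlinarith
  have hlim : Tendsto (fun t => (u 0 - N₀) * exp (μ * t)) atTop (nhds 0) := by
    have h : Tendsto (fun t => exp (μ * t)) atTop (nhds 0) :=
      tendsto_exp_atBot.comp (tendsto_id.const_mul_atTop_of_neg hμ)
    simpa using h.const_mul (u 0 - N₀)
  filter_upwards [hlim.eventually (gt_mem_nhds hε), eventually_ge_atTop 0] with t h1 ht
  have h2 : (u t - N₀) * exp (-μ * t) ≤ u 0 - N₀ := by
    simpa using hanti (mem_Ici.2 le_rfl) (mem_Ici.2 ht) ht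
  have h3 := mul_le_mul_of_nonneg_right h2 (exp_pos (μ * t)).le
  rw [mul_assoc, ← exp_add, neg_mul, neg_add_cancel, exp_zero, mul_one] at h3
  linarith

end Invariance

/-- If the `Q₂` system has only the trivial zero, then the corresponding system of inequalities
has only the trivial solution. -/
lemma eq_zero_of_le_windowBound {a c μ σ : ℝ} (ha : 0 < a) (hc : 0 < c) (hσμ : σ ≤ μ)
    (hμ : μ < 0)
    (huniq : ∀ M N : ℝ, M ∈ Icc (Mzero a c) (0:ℝ) → N ∈ Icc (0:ℝ) (Nzero a c μ σ) →
      Qtwo a c μ σ N M N = 0 → Qtwo a c μ σ M N M = 0 → M = 0 ∧ N = 0)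
    {ℓ L : ℝ} (hℓ : ℓ ∈ Icc (Mzero a c) (0:ℝ)) (hL : L ∈ Icc (0:ℝ) (Nzero a c μ σ))
    (hmax : L ≤ windowBound μ σ (a + c * L) ℓ (-(μ / σ * L)) (Dfun c μ σ ℓ L))
    (hmin : -ℓ ≤ windowBound μ σ (a + c * ℓ) (-L) (-(μ / σ * -ℓ)) (Dfun c μ σ ℓ L)) :
    ℓ = 0 ∧ L = 0 := by
  have hσ : σ < 0 := hσμ.trans_lt hμ
  have hρ : 0 < μ / σ := div_pos_of_neg_of_neg hμ hσ
  have hM₀ : Mzero a c < 0 := div_neg_of_neg_of_pos (by linarith) hc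
  have hcM : a + c * Mzero a c = 0 := by unfold Mzero; field_simp; ring
  have hMN : Mzero a c = -(μ / σ * Nzero a c μ σ) := by
    have := hσ.ne
    have := hμ.ne
    unfold Mzero Nzero; field_simp
  have hrN : ∀ {N : ℝ}, 0 ≤ N → 0 ≤ a + c * N := fun h => by positivity
  have hrM : ∀ {M : ℝ}, Mzero a c ≤ M → 0 ≤ a + c * M := fun h => by
    have := mul_le_mul_of_nonneg_left h hc.le
    linarith
  set P : ℝ × ℝ → ℝ := fun z =>
    windowBound μ σ (a + c * z.2) z.1 (-(μ / σ * z.2)) (Dfun c μ σ z.1 z.2)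
  set R : ℝ × ℝ → ℝ := fun z =>
    windowBound μ σ (a + c * z.1) (-z.2) (-(μ / σ * -z.1)) (Dfun c μ σ z.1 z.2) with hR
  have hPc : Continuous P := continuous_windowBound_comp (by fun_prop) (by fun_prop)
    (by fun_prop) (continuous_Dfun_comp (by fun_prop) (by fun_prop))
  have hRc : Continuous R := continuous_windowBound_comp (by fun_prop) (by fun_prop)
    (by fun_prop) (continuous_Dfun_comp (by fun_prop) (by fun_prop))
  set S : Set (ℝ × ℝ) := (Icc (Mzero a c) 0 ×ˢ Icc 0 (Nzero a c μ σ)) ∩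
    ({z | z.2 ≤ P z} ∩ {z | -z.1 ≤ R z})
  have hScpt : IsCompact S := (isCompact_Icc.prod isCompact_Icc).inter_right
    ((isClosed_le continuous_snd hPc).inter (isClosed_le continuous_fst.neg hRc))
  obtain ⟨⟨M, N⟩, ⟨⟨hM, hN⟩, hMP, hMR⟩, hopt⟩ := hScpt.exists_isMaxOn
    ⟨(ℓ, L), ⟨hℓ, hL⟩, hmax, hmin⟩ (f := fun z => z.2 - z.1)
    (Continuous.continuousOn (by fun_prop))
  simp only [mem_ofPred_eq] at hM hN hMP hMR
  have hD : ∀ x y, 0 ≤ Dfun c μ σ x y := Dfun_nonneg hc.le μ σ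
  have hNeq : N = P (M, N) := by
    by_contra hne
    have hlt : N < P (M, N) := lt_of_le_of_ne hMP hne
    have hNlt : N < Nzero a c μ σ := by
      refine lt_of_le_of_ne hN.2 fun hEq => ?_
      have h1 : P (M, N) ≤ windowBound μ σ (a + c * N) (Mzero a c) (-(μ / σ * N))
          (Dfun c μ σ M N) := windowBound_mono hσ (hrN hN.1) hM.1 le_rfl
      rw [windowBound_of_le hμ.ne (hrN hN.1) (hD _ _) (by rw [hEq, hMN]), hEq, ← hMN] at h1
      have h2 : σ / μ * Mzero a c = -Nzero a c μ σ := by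
        rw [div_mul_eq_mul_div, mul_Mzero_eq hc.ne' hμ.ne, neg_div, mul_div_cancel_left₀ _ hμ.ne]
      rw [h2] at h1
      rw [hEq] at hlt
      have hN₀ := hEq ▸ hN.1
      have := exp_pos (μ * (a + c * Nzero a c μ σ))
      nlinarith
    have hnear : ∀ᶠ y in nhdsWithin N (Ioi N), y < P (M, y) :=
      nhdsWithin_le_nhds ((isOpen_lt continuous_id
        (hPc.comp (Continuous.prodMk_right M))).mem_nhds hlt)
    obtain ⟨y, hy, hyI⟩ := (hnear.and (Ioo_mem_nhdsGT hNlt)).exists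
    have hmem : (M, y) ∈ S := by
      refine ⟨⟨hM, hN.1.trans hyI.1.le, hyI.2.le⟩, hy.le, hMR.trans ?_⟩
      refine windowBound_mono hσ (hrM hM.1) (neg_le_neg hyI.1.le) (Dfun_mono hc.le _ _ ?_)
      simp only
      rw [abs_of_nonneg hN.1, abs_of_nonneg (hN.1.trans hyI.1.le)]
      exact max_le_max le_rfl hyI.1.le
    have := hopt hmem
    simp only [mem_ofPred_eq] at this
    linarith [hyI.1]
  have hMeq : -M = R (M, N) := by
    by_contra hne
    have hlt : -M < R (M, N) := lt_of_le_of_ne hMR hne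
    have hMlt : Mzero a c < M := by
      refine lt_of_le_of_ne hM.1 fun hEq => ?_
      have h1 : R (M, N) = μ / σ * M := by
        simp only [hR, ← hEq, hcM, windowBound]
        simp
      rw [h1, ← hEq] at hlt
      nlinarith
    have hnear : ∀ᶠ x in nhdsWithin M (Iio M), -x < R (x, N) :=
      nhdsWithin_le_nhds ((isOpen_lt continuous_neg
        (hRc.comp (Continuous.prodMk_left N))).mem_nhds hlt)
    obtain ⟨x, hx, hxI⟩ := (hnear.and (Ioo_mem_nhdsLT hMlt)).exists
    have hmem : (x, N) ∈ S := by
      refine ⟨⟨⟨hxI.1.le, hxI.2.le.trans hM.2⟩, hN⟩, hMP.trans ?_, hx.le⟩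
      refine windowBound_mono hσ (hrN hN.1) hxI.2.le (Dfun_mono hc.le _ _ ?_)
      simp only
      rw [abs_of_nonpos hM.2, abs_of_nonpos (hxI.2.le.trans hM.2)]
      exact max_le_max (neg_le_neg hxI.2.le) le_rfl
    have := hopt hmem
    simp only [mem_ofPred_eq] at this
    linarith [hxI.2]
  have hzero : M = 0 ∧ N = 0 := by
    rcases (hM.2.trans hN.1).eq_or_lt with h | h
    · exact ⟨by linarith [hM.2, hN.1], by linarith [hM.2, hN.1]⟩
    · have h1 := le_of_le_windowBound hμ hσ (hrN hN.1) (hD _ _) hM.2 hN.1 hMP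
      have h2 := le_of_le_windowBound hμ hσ (hrM hM.1) (hD _ _) (neg_nonpos.2 hN.1)
        (neg_nonneg.2 hM.2) hMR
      refine huniq M N hM hN ?_ ?_
      · rw [Qtwo_eq_of_lt hμ.ne hσ.ne hc.le (hrN hN.1) h h1]
        exact sub_eq_zero.2 hNeq
      · rw [Qtwo_eq_of_gt hμ.ne hσ.ne hc.le (hrM hM.1) h (by linarith), Dfun_comm]
        have : M + R (M, N) = 0 := by linarith
        exact this
  have := hopt (show (ℓ, L) ∈ S from ⟨⟨hℓ, hL⟩, hmax, hmin⟩)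
  simp only [mem_ofPred_eq, hzero.1, hzero.2] at this
  exact ⟨by linarith [hℓ.2, hL.1], by linarith [hℓ.2, hL.1]⟩

/-- Global asymptotic stability criterion, second-order version. -/
theorem sdde_gas_criterion_Q2
    (a c μ σ N τ : ℝ) (φ : ℝ → ℝ)
    (ha : 0 < a) (hc : 0 < c) (hσμ : σ ≤ μ) (hμ : μ < 0)
    (hN : N = max (Nzero a c μ σ) (φ 0)) (hτ : τ = a + c * N)
    (hφcont : Continuous φ)
    (hφ : ∀ t ∈ Set.Icc (-τ) (0:ℝ), Mzero a c ≤ φ t)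
    (huniq : ∀ M N' : ℝ, M ∈ Set.Icc (Mzero a c) (0:ℝ) →
      N' ∈ Set.Icc (0:ℝ) (Nzero a c μ σ) →
      Qtwo a c μ σ N' M N' = 0 → Qtwo a c μ σ M N' M = 0 → M = 0 ∧ N' = 0) :
    ∀ u : ℝ → ℝ, IsSDDESolution a c μ σ φ u →
      Filter.Tendsto u Filter.atTop (nhds 0) := by
  intro u hu
  have hσ : σ < 0 := hσμ.trans_lt hμ
  have hN₀pos : 0 < Nzero a c μ σ :=
    div_pos_of_neg_of_neg (mul_neg_of_pos_of_neg ha hσ) (mul_neg_of_pos_of_neg hc hμ)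
  have hN₀ : Nzero a c μ σ ≤ N := hN ▸ le_max_left _ _
  have hφN : φ 0 ≤ N := hN ▸ le_max_right _ _
  have hcM : a + c * Mzero a c = 0 := by unfold Mzero; field_simp; ring
  have hτ0 : 0 ≤ τ := by
    have := mul_nonneg hc.le (hN₀pos.le.trans hN₀)
    linarith
  have hlow : ∀ t ≥ -τ, Mzero a c ≤ u t := by
    intro t ht
    rcases le_total t 0 with h | h
    · rw [hu.2.1 t h]; exact hφ t ⟨ht, h⟩
    · exact hu.Mzero_le ha hc hμ hσ (hφ 0 ⟨by linarith, le_rfl⟩) h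
  have hup : ∀ t ≥ 0, u t ≤ N := fun t ht =>
    hu.le_upper hc hμ hσ hN₀ hφN (fun t ht => hlow t (hτ ▸ ht)) ht
  have hdelay : ∀ t ≥ 0, 0 ≤ a + c * u t ∧ a + c * u t ≤ τ := by
    intro t ht
    have h1 := mul_le_mul_of_nonneg_left (hlow t (by linarith)) hc.le
    have h2 := mul_le_mul_of_nonneg_left (hup t ht) hc.le
    constructor <;> linarith
  have hbddA : IsBoundedUnder (· ≤ ·) atTop u :=
    ⟨N, eventually_map.2 ((eventually_ge_atTop 0).mono hup)⟩
  have hbddB : IsBoundedUnder (· ≥ ·) atTop u :=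
    ⟨Mzero a c, eventually_map.2 ((eventually_ge_atTop (-τ)).mono hlow)⟩
  set L := limsup u atTop
  set ℓ := liminf u atTop
  have hbound : ∀ ε > 0, ∀ᶠ t in atTop, ℓ - ε ≤ u t ∧ u t ≤ L + ε := by
    intro ε hε
    filter_upwards [eventually_lt_of_lt_liminf (show ℓ - ε < liminf u atTop by linarith) hbddB,
      eventually_lt_of_limsup_lt (show limsup u atTop < L + ε by linarith) hbddA] with t h1 h2
    exact ⟨h1.le, h2.le⟩
  have hfreqL : ∀ ε > 0, ∃ᶠ t in atTop, L - ε ≤ u t := fun ε hε =>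
    (frequently_lt_of_lt_limsup hbddB.isCoboundedUnder_flip
      (show L - ε < limsup u atTop by linarith)).mono fun _ h => h.le
  have hfreqℓ : ∀ ε > 0, ∃ᶠ t in atTop, -ℓ - ε ≤ -u t := fun ε hε =>
    (frequently_lt_of_liminf_lt hbddA.isCoboundedUnder_flip
      (show liminf u atTop < ℓ + ε by linarith)).mono fun _ h => by linarith
  have hde : ∀ t ≥ 1, HasDerivAt u (μ * u t + σ * u (t - a - c * u t)) t :=
    fun t ht => hu.2.2.2 t (by linarith)
  have hde' : ∀ t ≥ 1, HasDerivAt (fun t => -u t)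
      (μ * -u t + σ * -u (t - a - -c * -u t)) t := by
    intro t ht
    refine (hde t ht).neg.congr_deriv ?_
    rw [neg_mul_neg]
    ring
  have hdelay1 : ∀ t ≥ 1, 0 ≤ a + c * u t ∧ a + c * u t ≤ τ :=
    fun t ht => hdelay t (by linarith)
  have hdelay' : ∀ t ≥ 1, 0 ≤ a + -c * -u t ∧ a + -c * -u t ≤ τ := by
    intro t ht
    rw [neg_mul_neg]
    exact hdelay1 t ht
  have hℓmem : ℓ ∈ Icc (Mzero a c) 0 := by
    constructor
    · exact le_liminf_of_le hbddA.isCoboundedUnder_flip ((eventually_ge_atTop (-τ)).mono hlow)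
    · by_contra! hpos
      obtain ⟨T, hT⟩ := eventually_atTop.1 (hbound (ℓ / 2) (by linarith))
      refine not_bounded_below_by_pos (T := max 1 T) (η := ℓ / 2) hμ hσ
        (fun t ht => hde t ((le_max_left _ _).trans ht))
        (fun t ht => hdelay1 t ((le_max_left _ _).trans ht)) (by linarith)
        (fun t ht => ?_)
      linarith [(hT t ((le_max_right _ _).trans ht)).1]
  have hLmem : L ∈ Icc 0 (Nzero a c μ σ) := by
    constructor
    · by_contra! hneg
      obtain ⟨T, hT⟩ := eventually_atTop.1 (hbound (-L / 2) (by linarith))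
      refine not_bounded_below_by_pos (T := max 1 T) (η := -L / 2) hμ hσ
        (fun t ht => hde' t ((le_max_left _ _).trans ht))
        (fun t ht => hdelay' t ((le_max_left _ _).trans ht)) (by linarith)
        (fun t ht => ?_)
      linarith [(hT t ((le_max_right _ _).trans ht)).2]
    · refine le_of_forall_pos_le_add fun ε hε => ?_
      exact limsup_le_of_le hbddB.isCoboundedUnder_flip
        (hu.eventually_le_Nzero_add hc hμ hσ
          (fun t ht => hlow _ (by linarith [(hdelay t ht.le).2])) hε)
  have hmax := limsup_le_windowBound hu.1 hσ hde hdelay1 hbound hfreqL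
  have hmin := limsup_le_windowBound (u := fun t => -u t) (ℓ := -L) (L := -ℓ) hu.1.neg hσ
    hde' hdelay'
    (fun ε hε => (hbound ε hε).mono fun t h => ⟨by linarith [h.2], by linarith [h.1]⟩) hfreqℓ
  have hDneg : Dfun |-c| μ σ (-L) (-ℓ) = Dfun c μ σ ℓ L := by
    rw [Dfun_comm, abs_neg, abs_of_pos hc]
    simp only [Dfun, abs_neg]
  rw [abs_of_pos hc] at hmax
  rw [hDneg, neg_mul_neg] at hmin
  obtain ⟨hℓ0, hL0⟩ := eq_zero_of_le_windowBound ha hc hσμ hμ huniq hℓmem hLmem hmax hmin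
  exact tendsto_of_le_liminf_of_limsup_le hℓ0.ge hL0.le hbddA hbddB
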